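/- The probability that a uniformly random spanning tree of the complete graph K_{kn} is k-splittable equals ((kn)! / ((n!)^k · k!)) · n^{(n-2)k} · n^{2(k-1)} · k^{k-2} / (kn)^{kn-2}. -/

import Mathlib

open SimpleGraph

/-- A spanning tree `T` is `k`-splittable into pieces of size `n` if some `k-1` of its
edges can be removed so that each connected component of the result has `n` vertices. -/
def IsSplittable {V : Type*} [Fintype V] (T : SimpleGraph V) (k n : ℕ) : Prop :=
  ∃ F : Finset (Sym2 V), ↑F ⊆ T.edgeSet ∧ F.card = k - 1 ∧
    ∀ c : (T.deleteEdges ↑F).ConnectedComponent, c.supp.ncard = n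

/-- The number of spanning trees of `G`. -/
noncomputable def numSpanningTrees {V : Type*} [Fintype V] (G : SimpleGraph V) : ℕ :=
  Set.ncard {T : SimpleGraph V | T ≤ G ∧ T.IsTree}

/-- The number of `k`-splittable spanning trees of `G`. -/
noncomputable def numSplittableSpanningTrees {V : Type*} [Fintype V]
    (G : SimpleGraph V) (k n : ℕ) : ℕ :=
  Set.ncard {T : SimpleGraph V | T ≤ G ∧ T.IsTree ∧ IsSplittable T k n}

namespace SimpleGraph

variable {V : Type*} {F : SimpleGraph V} {u v : V}

theorem reachable_sup_edge_iff {x y : V} : (F ⊔ edge u v).Reachable x y ↔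
    F.Reachable x y ∨ (F.Reachable x u ∧ F.Reachable v y) ∨
      (F.Reachable x v ∧ F.Reachable u y) := by
  constructor
  · rintro ⟨p⟩
    induction p with
    | nil => exact .inl .rfl
    | cons h p ih =>
      rw [sup_adj, edge_adj] at h
      rcases h with h | ⟨⟨rfl, rfl⟩ | ⟨rfl, rfl⟩, -⟩
      · exact ih.imp h.reachable.trans
          (Or.imp (And.imp_left h.reachable.trans) (And.imp_left h.reachable.trans))
      · rcases ih with h | ⟨h, h'⟩ | ⟨h, h'⟩
        · exact .inr (.inl ⟨.rfl, h⟩)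
        · exact .inr (.inl ⟨.rfl, h'⟩)
        · exact .inl h'
      · rcases ih with h | ⟨h, h'⟩ | ⟨h, h'⟩
        · exact .inr (.inr ⟨.rfl, h⟩)
        · exact .inl h'
        · exact .inr (.inr ⟨.rfl, h'⟩)
  · have hle : F ≤ F ⊔ edge u v := le_sup_left
    have huv : (F ⊔ edge u v).Reachable u v := by
      by_cases h : u = v
      · exact h ▸ .rfl
      · exact Adj.reachable (by simp [edge_adj, h])
    rintro (h | ⟨h, h'⟩ | ⟨h, h'⟩)
    · exact h.mono hle
    · exact (h.mono hle).trans (huv.trans (h'.mono hle))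
    · exact (h.mono hle).trans (huv.symm.trans (h'.mono hle))

/-- Joining two components by an edge identifies the components of the new graph with all old
components but one. -/
theorem bijective_map_sup_edge (huv : ¬ F.Reachable u v) :
    Function.Bijective (fun c : {c : F.ConnectedComponent // c ≠ F.connectedComponentMk v} ↦
      c.1.map (Hom.ofLE (le_sup_left : F ≤ F ⊔ edge u v))) := by
  constructor
  · rintro ⟨c, hc⟩ ⟨d, hd⟩ h
    induction c using ConnectedComponent.ind with | _ x
    induction d using ConnectedComponent.ind with | _ y
    simp only [ConnectedComponent.map_mk, ConnectedComponent.eq, Hom.coe_ofLE, id,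
      reachable_sup_edge_iff, ne_eq, Subtype.mk.injEq] at h hc hd ⊢
    rcases h with h | ⟨-, h⟩ | ⟨h, -⟩
    · exact h
    · exact absurd h.symm hd
    · exact absurd h hc
  · intro c
    induction c using ConnectedComponent.ind with | _ x
    by_cases hx : F.Reachable x v
    · refine ⟨⟨F.connectedComponentMk u, by simpa using huv⟩, ?_⟩
      simpa [reachable_sup_edge_iff] using .inr (.inl hx.symm)
    · exact ⟨⟨F.connectedComponentMk x, by simpa using hx⟩, rfl⟩

theorem supp_map_sup_edge_of_ne {c : F.ConnectedComponent} (hu : c ≠ F.connectedComponentMk u)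
    (hv : c ≠ F.connectedComponentMk v) :
    (c.map (Hom.ofLE (le_sup_left : F ≤ F ⊔ edge u v))).supp = c.supp := by
  induction c using ConnectedComponent.ind with | _ x
  ext y
  simp only [ne_eq, ConnectedComponent.eq] at hu hv
  simp only [ConnectedComponent.map_mk, ConnectedComponent.mem_supp_iff, ConnectedComponent.eq,
    Hom.coe_ofLE, id, reachable_sup_edge_iff, F.reachable_comm (u := v) (v := x),
    F.reachable_comm (u := u) (v := x), hu, hv, and_false, or_false]

theorem supp_map_sup_edge_left :
    ((F.connectedComponentMk u).map (Hom.ofLE (le_sup_left : F ≤ F ⊔ edge u v))).supp =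
      (F.connectedComponentMk u).supp ∪ (F.connectedComponentMk v).supp := by
  ext y
  simp only [ConnectedComponent.map_mk, ConnectedComponent.mem_supp_iff, ConnectedComponent.eq,
    Hom.coe_ofLE, id, reachable_sup_edge_iff, Set.mem_union, Reachable.rfl, and_true]
  refine ⟨?_, ?_⟩
  · rintro (h | ⟨h, -⟩ | h) <;> simp [h]
  · rintro (h | h) <;> simp [h]

theorem IsAcyclic.isTree_of_card_connectedComponent (hF : F.IsAcyclic)
    (h : Nat.card F.ConnectedComponent = 1) : F.IsTree := by
  obtain ⟨hs, ⟨c⟩⟩ := Nat.card_eq_one_iff_unique.1 h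
  induction c using ConnectedComponent.ind with | _ x
  have : Nonempty V := ⟨x⟩
  exact ⟨⟨fun u v ↦ ConnectedComponent.eq.1 (Subsingleton.elim _ _)⟩, hF⟩

/-- The number of vertices in the component of `v`. -/
noncomputable def compCard (F : SimpleGraph V) (v : V) : ℕ :=
  (F.connectedComponentMk v).supp.ncard

/-- The product of the sizes of all components. -/
noncomputable def compProd (F : SimpleGraph V) : ℕ :=
  ∏ᶠ c : F.ConnectedComponent, c.supp.ncard

variable [Fintype V]

theorem compCard_pos (F : SimpleGraph V) (v : V) : 0 < F.compCard v :=
  (Set.ncard_pos).2 (ConnectedComponent.nonempty_supp _)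

theorem card_connectedComponent_sup_edge (huv : ¬ F.Reachable u v) :
    Nat.card (F ⊔ edge u v).ConnectedComponent + 1 = Nat.card F.ConnectedComponent := by
  classical
  rw [← Nat.card_congr (Equiv.ofBijective _ (bijective_map_sup_edge huv))]
  have := Fintype.ofFinite F.ConnectedComponent
  have : 0 < Fintype.card F.ConnectedComponent := Fintype.card_pos_iff.2 ⟨F.connectedComponentMk v⟩
  simp only [Nat.card_eq_fintype_card, ne_eq, Fintype.card_subtype_compl, Fintype.card_unique]
  omega

theorem compProd_sup_edge (huv : ¬ F.Reachable u v) :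
    (F ⊔ edge u v).compProd * (F.compCard u * F.compCard v) =
      F.compProd * (F.compCard u + F.compCard v) := by
  classical
  have := Fintype.ofFinite F.ConnectedComponent
  have huv' : F.connectedComponentMk u ≠ F.connectedComponentMk v := by simpa using huv
  have key : (F ⊔ edge u v).compProd = ∏ c ∈ Finset.univ.erase (F.connectedComponentMk v),
      (c.map (Hom.ofLE (le_sup_left : F ≤ F ⊔ edge u v))).supp.ncard := by
    rw [compProd, ← finprod_comp _ (bijective_map_sup_edge huv), finprod_eq_prod_of_fintype]
    exact (Finset.prod_subtype _ (by simp)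
      (fun c : F.ConnectedComponent ↦
        (c.map (Hom.ofLE (le_sup_left : F ≤ F ⊔ edge u v))).supp.ncard)).symm
  have hmem : F.connectedComponentMk u ∈ Finset.univ.erase (F.connectedComponentMk v) := by
    simpa using huv
  rw [key, ← Finset.mul_prod_erase _ _ hmem, compProd, finprod_eq_prod_of_fintype,
    ← Finset.mul_prod_erase _ _ (Finset.mem_univ (F.connectedComponentMk v)),
    ← Finset.mul_prod_erase _ _ hmem, supp_map_sup_edge_left, Set.ncard_union_eq]
  · rw [Finset.prod_congr rfl fun c hc ↦ congrArg Set.ncard (supp_map_sup_edge_of_ne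
      (Finset.ne_of_mem_erase hc) (Finset.ne_of_mem_erase (Finset.mem_of_mem_erase hc)))]
    simp only [compCard]
    ring
  · exact F.pairwise_disjoint_supp_connectedComponent huv'

theorem exists_not_reachable (h : 1 < Nat.card F.ConnectedComponent) :
    ∃ u v, ¬ F.Reachable u v := by
  have := (Finite.one_lt_card_iff_nontrivial).1 h
  obtain ⟨c, d, hcd⟩ := exists_pair_ne F.ConnectedComponent
  induction c using ConnectedComponent.ind with | _ x
  induction d using ConnectedComponent.ind with | _ y
  exact ⟨x, y, by simpa using hcd⟩

theorem IsAcyclic.card_edgeSet_add_card_connectedComponent (hF : F.IsAcyclic) :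
    F.edgeSet.ncard + Nat.card F.ConnectedComponent = Fintype.card V := by
  classical
  obtain ⟨k, hk⟩ : ∃ k, Nat.card F.ConnectedComponent = k := ⟨_, rfl⟩
  induction k using Nat.strong_induction_on generalizing F with | _ k ih
  rcases lt_trichotomy k 1 with h | rfl | h
  · have : IsEmpty V := by
      by_contra hV
      obtain ⟨v⟩ := not_isEmpty_iff.1 hV
      have := Nat.card_pos_iff.2 ⟨⟨F.connectedComponentMk v⟩, inferInstance⟩
      omega
    have : F.edgeSet = ∅ := by
      ext e
      induction e with | _ x y
      exact isEmptyElim x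
    rw [this]
    simp
  · rw [hk, ← (hF.isTree_of_card_connectedComponent hk).card_edgeFinset, ← coe_edgeFinset,
      Set.ncard_coe_finset]
  · obtain ⟨u, v, huv⟩ := exists_not_reachable (hk ▸ h)
    have hc := card_connectedComponent_sup_edge huv
    have := ih _ (by omega) (hF.sup_edge_of_not_reachable huv) rfl
    have hne : u ≠ v := fun h ↦ huv (h ▸ .rfl)
    rw [edgeSet_sup, edgeSet_edge_of_ne hne, Set.union_singleton, Set.ncard_insert_of_notMem
      (fun h : s(u, v) ∈ F.edgeSet ↦ huv (Adj.reachable h))] at this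
    omega

end SimpleGraph

namespace SimpleGraph

variable {V : Type*} {F T : SimpleGraph V} {u v : V}

theorem IsAcyclic.adj_of_reachable_of_le (hT : T.IsAcyclic) (hle : F ≤ T) (h : T.Adj u v)
    (hr : F.Reachable u v) : F.Adj u v := by
  by_contra hn
  refine ((isAcyclic_iff_forall_adj_isBridge.1 hT) h) (hr.mono fun x y hxy ↦ ?_)
  rw [deleteEdges_adj]
  refine ⟨hle hxy, fun he ↦ hn ?_⟩
  rwa [← mem_edgeSet, ← Set.mem_singleton_iff.1 he, mem_edgeSet]

/-- The number of trees containing `F`. -/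
noncomputable def numTreesAbove (F : SimpleGraph V) : ℕ :=
  {T : SimpleGraph V | F ≤ T ∧ T.IsTree}.ncard

variable [Fintype V]

theorem sum_inv_compCard (F : SimpleGraph V) :
    ∑ v, (F.compCard v : ℚ)⁻¹ = Nat.card F.ConnectedComponent := by
  classical
  have := Fintype.ofFinite F.ConnectedComponent
  rw [← Finset.sum_fiberwise Finset.univ F.connectedComponentMk, Nat.card_eq_fintype_card,
    Fintype.card, Finset.card_eq_sum_ones, Nat.cast_sum]
  refine Finset.sum_congr rfl fun c _ ↦ ?_
  have h : ∀ v ∈ Finset.univ.filter (F.connectedComponentMk · = c),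
      (F.compCard v : ℚ)⁻¹ = (c.supp.ncard : ℚ)⁻¹ := by
    intro v hv
    rw [compCard, (Finset.mem_filter.1 hv).2]
  have h' : (Finset.univ.filter (F.connectedComponentMk · = c)).card = c.supp.ncard := by
    rw [← Set.ncard_coe_finset]
    congr 1
    ext
    simp
  have : (c.supp.ncard : ℚ) ≠ 0 := by
    exact_mod_cast ((Set.ncard_pos).2 c.nonempty_supp).ne'
  rw [Finset.sum_congr rfl h, Finset.sum_const, h', nsmul_eq_mul, mul_inv_cancel₀ this, Nat.cast_one]

open Classical in
theorem card_not_reachable_add (F : SimpleGraph V) (u : V) :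
    (Finset.univ.filter fun v ↦ ¬ F.Reachable u v).card + F.compCard u = Fintype.card V := by
  have h : F.compCard u = (Finset.univ.filter fun v ↦ F.Reachable u v).card := by
    rw [compCard, ← Set.ncard_coe_finset]
    congr 1
    ext
    simp [reachable_comm]
  rw [h, add_comm, Finset.card_filter_add_card_filter_not, Finset.card_univ]

open Classical in
theorem sum_not_reachable_inv_compCard (F : SimpleGraph V) :
    ∑ p : V × V with ¬ F.Reachable p.1 p.2, (F.compCard p.1 : ℚ)⁻¹ =
      Fintype.card V * (Nat.card F.ConnectedComponent - 1) := by
  rw [Finset.sum_filter, Fintype.sum_prod_type]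
  have (u : V) : (∑ v, if ¬ F.Reachable u v then (F.compCard u : ℚ)⁻¹ else 0) =
      Fintype.card V * (F.compCard u : ℚ)⁻¹ - 1 := by
    have h : (F.compCard u : ℚ) ≠ 0 := by exact_mod_cast (F.compCard_pos u).ne'
    rw [← Finset.sum_filter, Finset.sum_const, nsmul_eq_mul, ← F.card_not_reachable_add u]
    push_cast
    field_simp
    ring
  simp only [this, Finset.sum_sub_distrib, ← Finset.mul_sum, sum_inv_compCard]
  simp
  ring

open Classical in
theorem card_filter_adj (G : SimpleGraph V) :
    (Finset.univ.filter fun p : V × V ↦ G.Adj p.1 p.2).card = 2 * G.edgeSet.ncard := by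
  rw [← coe_edgeFinset, Set.ncard_coe_finset, ← sum_degrees_eq_twice_card_edges,
    Finset.card_filter, Fintype.sum_prod_type]
  exact Finset.sum_congr rfl fun u _ ↦ by
    rw [← Finset.card_filter, ← card_neighborFinset_eq_degree, neighborFinset_eq_filter]

open Classical in
theorem IsTree.card_not_reachable_adj (hT : T.IsTree) (hle : F ≤ T) :
    (Finset.univ.filter fun p : V × V ↦ ¬ F.Reachable p.1 p.2 ∧ T.Adj p.1 p.2).card + 2 =
      2 * Nat.card F.ConnectedComponent := by
  have h1 : (Finset.univ.filter fun p : V × V ↦ ¬ F.Reachable p.1 p.2 ∧ T.Adj p.1 p.2).card =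
      2 * (T \ F).edgeSet.ncard := by
    rw [← card_filter_adj]
    congr 1
    ext p
    simp only [Finset.mem_filter, Finset.mem_univ, true_and, sdiff_adj]
    exact ⟨fun h ↦ ⟨h.2, fun h' ↦ h.1 h'.reachable⟩,
      fun h ↦ ⟨fun h' ↦ h.2 (hT.isAcyclic.adj_of_reachable_of_le hle h.1 h'), h.1⟩⟩
  have h2 := Set.ncard_sdiff_add_ncard_of_subset (edgeSet_subset_edgeSet.2 hle)
  have h3 := (hT.isAcyclic.anti hle).card_edgeSet_add_card_connectedComponent
  have h4 := hT.card_edgeFinset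
  rw [← Set.ncard_coe_finset, coe_edgeFinset] at h4
  rw [h1, edgeSet_sdiff]
  omega

open Classical in
theorem sum_numTreesAbove_sup_edge (F : SimpleGraph V) :
    ∑ p : V × V with ¬ F.Reachable p.1 p.2, ((F ⊔ edge p.1 p.2).numTreesAbove : ℚ) =
      2 * (Nat.card F.ConnectedComponent - 1) * F.numTreesAbove := by
  have := Finset.sum_card_bipartiteAbove_eq_sum_card_bipartiteBelow
    (s := Finset.univ.filter fun p : V × V ↦ ¬ F.Reachable p.1 p.2)
    (t := Finset.univ.filter fun T : SimpleGraph V ↦ F ≤ T ∧ T.IsTree)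
    (fun p T ↦ T.Adj p.1 p.2)
  rw [← Nat.cast_sum]
  have h1 : ∀ p ∈ Finset.univ.filter fun p : V × V ↦ ¬ F.Reachable p.1 p.2,
      (F ⊔ edge p.1 p.2).numTreesAbove = (Finset.bipartiteAbove (fun p T ↦ T.Adj p.1 p.2)
        (Finset.univ.filter fun T : SimpleGraph V ↦ F ≤ T ∧ T.IsTree) p).card := by
    intro p hp
    have hne : p.1 ≠ p.2 := fun h ↦ (Finset.mem_filter.1 hp).2 (h ▸ .rfl)
    rw [numTreesAbove, ← Set.ncard_coe_finset]
    congr 1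
    ext T
    simp [Finset.bipartiteAbove, hne]
    tauto
  rw [Finset.sum_congr rfl h1, this, Nat.cast_sum, Finset.sum_congr rfl (g := fun _ ↦
    2 * ((Nat.card F.ConnectedComponent : ℚ) - 1))]
  · rw [Finset.sum_const, nsmul_eq_mul, numTreesAbove, ← Set.ncard_coe_finset, mul_comm]
    simp
  · intro T hT
    have h := (Finset.mem_filter.1 hT).2
    have := h.2.card_not_reachable_adj h.1
    rw [Finset.bipartiteBelow, Finset.filter_filter, mul_sub, ← Nat.cast_two, ← Nat.cast_mul,
      ← this]
    push_cast
    ring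

/-- The number of trees on `N` labelled vertices containing a given forest with components of
sizes `a₁, …, aₖ` is `N ^ (k - 2) * (a₁ * ⋯ * aₖ)`. -/
theorem IsAcyclic.numTreesAbove_mul_sq [Nonempty V] (hF : F.IsAcyclic) :
    F.numTreesAbove * Fintype.card V ^ 2 =
      Fintype.card V ^ Nat.card F.ConnectedComponent * F.compProd := by
  classical
  obtain ⟨k, hk⟩ : ∃ k, Nat.card F.ConnectedComponent = k + 1 :=
    Nat.exists_eq_succ_of_ne_zero
      (Nat.card_pos_iff.2 ⟨⟨F.connectedComponentMk (Classical.arbitrary V)⟩, inferInstance⟩).ne'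
  induction k generalizing F with
  | zero =>
    have hT := hF.isTree_of_card_connectedComponent hk
    have h1 : F.numTreesAbove = 1 := by
      rw [numTreesAbove, Set.ncard_eq_one]
      refine ⟨F, Set.eq_singleton_iff_unique_mem.2 ⟨⟨le_rfl, hT⟩, fun T h ↦ ?_⟩⟩
      refine le_antisymm (fun u v huv ↦ ?_) h.1
      exact h.2.isAcyclic.adj_of_reachable_of_le h.1 huv (hT.connected u v)
    have h2 : F.compProd = Fintype.card V := by
      have hc (c : F.ConnectedComponent) : c.supp.ncard = Fintype.card V := by
        induction c using ConnectedComponent.ind with | _ x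
        rw [← Nat.card_eq_fintype_card, ← Set.ncard_univ]
        congr 1
        ext y
        simpa using hT.connected y x
      have := Fintype.ofFinite F.ConnectedComponent
      rw [compProd, finprod_eq_prod_of_fintype, Finset.prod_congr rfl fun c _ ↦ hc c,
        Finset.prod_const, Finset.card_univ,
        ← Nat.card_eq_fintype_card (α := F.ConnectedComponent), hk, zero_add, pow_one]
    rw [h1, h2, hk]
    ring
  | succ k ih =>
    have key : (∑ p : V × V with ¬ F.Reachable p.1 p.2,
        ((F ⊔ edge p.1 p.2).numTreesAbove : ℚ)) * Fintype.card V ^ 2 =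
        Fintype.card V ^ (k + 1) * F.compProd *
          (2 * (Fintype.card V * (Nat.card F.ConnectedComponent - 1))) := by
      have hswap : ∑ p : V × V with ¬ F.Reachable p.1 p.2, (F.compCard p.2 : ℚ)⁻¹ =
          ∑ p : V × V with ¬ F.Reachable p.1 p.2, (F.compCard p.1 : ℚ)⁻¹ :=
        Finset.sum_equiv (Equiv.prodComm V V) (by simp [reachable_comm]) (by simp)
      rw [two_mul, ← sum_not_reachable_inv_compCard]
      nth_rw 1 [← hswap]
      rw [← Finset.sum_add_distrib, Finset.sum_mul, Finset.mul_sum]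
      refine Finset.sum_congr rfl fun p hp ↦ ?_
      have hp := (Finset.mem_filter.1 hp).2
      have hc := card_connectedComponent_sup_edge hp
      have h1 := ih (hF.sup_edge_of_not_reachable hp) (by omega)
      have h2 := compProd_sup_edge hp
      rw [show Nat.card (F ⊔ edge p.1 p.2).ConnectedComponent = k + 1 by omega] at h1
      have hu : (F.compCard p.1 : ℚ) ≠ 0 := by exact_mod_cast (F.compCard_pos p.1).ne'
      have hv : (F.compCard p.2 : ℚ) ≠ 0 := by exact_mod_cast (F.compCard_pos p.2).ne'
      have h1' : ((F ⊔ edge p.1 p.2).numTreesAbove : ℚ) * Fintype.card V ^ 2 =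
        Fintype.card V ^ (k + 1) * (F ⊔ edge p.1 p.2).compProd := by exact_mod_cast h1
      have h2' : ((F ⊔ edge p.1 p.2).compProd : ℚ) * (F.compCard p.1 * F.compCard p.2) =
        F.compProd * (F.compCard p.1 + F.compCard p.2) := by exact_mod_cast h2
      rw [h1']
      field_simp
      linear_combination h2'
    rw [sum_numTreesAbove_sup_edge, hk] at key
    rw [hk]
    have hk' : (2 * (k + 1) : ℚ) ≠ 0 := by positivity
    have : (F.numTreesAbove : ℚ) * Fintype.card V ^ 2 =
        Fintype.card V ^ (k + 1 + 1) * F.compProd := by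
      refine mul_left_cancel₀ hk' ?_
      push_cast at key
      linear_combination key
    exact_mod_cast this

end SimpleGraph

namespace SimpleGraph

variable {V : Type*} {T H H' : SimpleGraph V} {k n : ℕ}

/-- The forests all of whose components have `n` vertices. -/
def equiForests (V : Type*) (n : ℕ) : Set (SimpleGraph V) :=
  {H | H.IsAcyclic ∧ ∀ c : H.ConnectedComponent, c.supp.ncard = n}

variable [Fintype V]

theorem dvd_ncard_of_forall_adj_mem (hH : ∀ c : H.ConnectedComponent, c.supp.ncard = n) {S : Set V}
    (hS : ∀ x ∈ S, ∀ y, H.Adj x y → y ∈ S) : n ∣ S.ncard := by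
  classical
  have := Fintype.ofFinite H.ConnectedComponent
  have hS' : ∀ x ∈ S, ∀ y, H.Reachable x y → y ∈ S := by
    rintro x hx y ⟨p⟩
    induction p with
    | nil => exact hx
    | cons h p ih => exact ih (hS _ hx _ h)
  rw [Set.ncard_eq_toFinset_card', Finset.card_eq_sum_card_fiberwise
    (f := H.connectedComponentMk) (t := Finset.univ) (by simp)]
  refine Finset.dvd_sum fun c _ ↦ ?_
  rcases (S.toFinset.filter (H.connectedComponentMk · = c)).eq_empty_or_nonempty with
    h | ⟨x, h⟩
  · simp [h]
  · obtain ⟨hx, rfl⟩ := Finset.mem_filter.1 h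
    rw [← hH (H.connectedComponentMk x), ← Set.ncard_coe_finset]
    refine dvd_of_eq (congrArg _ ?_)
    ext y
    simp only [ConnectedComponent.mem_supp_iff, ConnectedComponent.eq, Finset.coe_filter,
      Set.mem_toFinset, Set.mem_ofPred_eq]
    exact ⟨fun h ↦ ⟨hS' x (by simpa using hx) y h.symm, h⟩, And.right⟩

theorem card_connectedComponent_mul (hH : ∀ c : H.ConnectedComponent, c.supp.ncard = n) :
    Nat.card H.ConnectedComponent * n = Fintype.card V := by
  classical
  have := Fintype.ofFinite H.ConnectedComponent
  rw [← Finset.card_univ, Finset.card_eq_sum_card_fiberwise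
    (f := H.connectedComponentMk) (t := Finset.univ) (by simp), Finset.sum_congr rfl
    (g := fun _ ↦ n), Finset.sum_const, Finset.card_univ, Nat.card_eq_fintype_card, smul_eq_mul]
  intro c _
  rw [← hH c, ← Set.ncard_coe_finset]
  congr 1
  ext
  simp

/-- A forest has at most one spanning subgraph all of whose components have `n` vertices. -/
theorem IsAcyclic.le_of_forall_ncard_supp_eq (hT : T.IsAcyclic) (hle : H ≤ T) (hle' : H' ≤ T)
    (hH : ∀ c : H.ConnectedComponent, c.supp.ncard = n)
    (hH' : ∀ c : H'.ConnectedComponent, c.supp.ncard = n) : H ≤ H' := by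
  intro u v huv
  by_contra hn
  set T' := T.deleteEdges {s(u, v)} with hT'
  have hbridge : ¬ T'.Reachable u v := isAcyclic_iff_forall_adj_isBridge.1 hT (hle huv)
  set A : Set V := {x | T'.Reachable u x} with hA
  set c := H.connectedComponentMk u with hc
  have hvc : v ∈ c.supp := by simpa [hc] using huv.symm.reachable
  have h1 : n ∣ A.ncard := by
    refine dvd_ncard_of_forall_adj_mem hH' fun x hx y hxy ↦ hx.trans (Adj.reachable ?_)
    rw [hT', deleteEdges_adj]
    refine ⟨hle' hxy, fun he ↦ hn ?_⟩
    rwa [← mem_edgeSet, ← Set.mem_singleton_iff.1 he, mem_edgeSet]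
  have h2 : n ∣ (A \ c.supp).ncard := by
    refine dvd_ncard_of_forall_adj_mem hH fun x hx y hxy ↦ ?_
    have hyc : y ∉ c.supp := fun hy ↦ hx.2 ((c.mem_supp_congr_adj hxy).2 hy)
    refine ⟨hx.1.trans (Adj.reachable ?_), hyc⟩
    rw [hT', deleteEdges_adj]
    refine ⟨hle hxy, fun he ↦ ?_⟩
    rcases Sym2.eq_iff.1 (Set.mem_singleton_iff.1 he) with ⟨rfl, rfl⟩ | ⟨rfl, rfl⟩
    · exact hyc hvc
    · exact hx.2 hvc
  rw [← Set.ncard_inter_add_ncard_sdiff_eq_ncard A c.supp, Nat.dvd_add_left h2] at h1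
  have hpos : 0 < (A ∩ c.supp).ncard := (Set.ncard_pos).2 ⟨u, .rfl, rfl⟩
  have hlt : (A ∩ c.supp).ncard < c.supp.ncard :=
    Set.ncard_lt_ncard ⟨Set.inter_subset_right, fun h ↦ hbridge (h hvc).1⟩
  rw [hH c] at hlt
  exact absurd (Nat.le_of_dvd hpos h1) (not_le.2 hlt)

theorem IsTree.isSplittable_iff (hT : T.IsTree) (hn : 1 ≤ n) (hV : Fintype.card V = k * n) :
    IsSplittable T k n ↔ ∃ H ≤ T, ∀ c : H.ConnectedComponent, c.supp.ncard = n := by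
  classical
  constructor
  · rintro ⟨F, -, -, h⟩
    exact ⟨_, deleteEdges_le _, h⟩
  · rintro ⟨H, hle, h⟩
    have hdel : T.deleteEdges ↑(T.edgeFinset \ H.edgeFinset) = H := by
      ext u v
      have := @hle u v
      simp [deleteEdges_adj]
      tauto
    refine ⟨T.edgeFinset \ H.edgeFinset, by simp, ?_, by rwa [hdel]⟩
    have h1 := card_connectedComponent_mul h
    rw [hV] at h1
    have h1 := Nat.eq_of_mul_eq_mul_right hn h1
    have h2 := (hT.isAcyclic.anti hle).card_edgeSet_add_card_connectedComponent
    have h3 := hT.card_edgeFinset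
    rw [← coe_edgeFinset, Set.ncard_coe_finset] at h2
    rw [Finset.card_sdiff_of_subset (edgeFinset_mono hle)]
    omega

theorem numSplittableSpanningTrees_top_mul_sq [Nonempty V] (hn : 1 ≤ n)
    (hV : Fintype.card V = k * n) :
    numSplittableSpanningTrees (⊤ : SimpleGraph V) k n * (k * n) ^ 2 =
      (equiForests V n).ncard * ((k * n) ^ k * n ^ k) := by
  classical
  have h1 : numSplittableSpanningTrees (⊤ : SimpleGraph V) k n =
      ∑ H ∈ (equiForests V n).toFinset, H.numTreesAbove := by
    have h (H : SimpleGraph V) : H.numTreesAbove =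
        (Finset.univ.filter fun T : SimpleGraph V ↦ H ≤ T ∧ T.IsTree).card := by
      rw [numTreesAbove, ← Set.ncard_coe_finset]
      simp
    rw [Finset.sum_congr rfl fun H _ ↦ h H, ← Finset.card_biUnion, numSplittableSpanningTrees,
      ← Set.ncard_coe_finset]
    · congr 1
      ext T
      simp only [le_top, true_and, Set.mem_ofPred_eq, Finset.mem_coe, Finset.mem_biUnion,
        Set.mem_toFinset, Finset.mem_filter, Finset.mem_univ]
      constructor
      · rintro ⟨hT, hs⟩
        obtain ⟨H, hle, h⟩ := (hT.isSplittable_iff hn hV).1 hs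
        exact ⟨H, ⟨hT.isAcyclic.anti hle, h⟩, hle, hT⟩
      · rintro ⟨H, ⟨-, h⟩, hle, hT⟩
        exact ⟨hT, (hT.isSplittable_iff hn hV).2 ⟨H, hle, h⟩⟩
    · intro H hH H' hH' hne
      rw [Function.onFun, Finset.disjoint_left]
      intro T hT hT'
      simp only [Finset.mem_filter, Finset.mem_univ, true_and] at hT hT'
      simp only [Finset.mem_coe, Set.mem_toFinset] at hH hH'
      exact hne (le_antisymm
        (hT.2.isAcyclic.le_of_forall_ncard_supp_eq hT.1 hT'.1 hH.2 hH'.2)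
        (hT.2.isAcyclic.le_of_forall_ncard_supp_eq hT'.1 hT.1 hH'.2 hH.2))
  rw [h1, Finset.sum_mul, Finset.sum_congr rfl (g := fun _ ↦ (k * n) ^ k * n ^ k),
    Finset.sum_const, smul_eq_mul, Set.ncard_eq_toFinset_card']
  intro H hH
  rw [Set.mem_toFinset] at hH
  have hk := card_connectedComponent_mul hH.2
  rw [hV] at hk
  have := Fintype.ofFinite H.ConnectedComponent
  have hk := Nat.eq_of_mul_eq_mul_right hn hk
  rw [← hV, hH.1.numTreesAbove_mul_sq, hk, compProd, finprod_eq_prod_of_fintype,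
    Finset.prod_congr rfl fun c _ ↦ hH.2 c, Finset.prod_const, Finset.card_univ,
    ← Nat.card_eq_fintype_card (α := H.ConnectedComponent), hk]

/-- The Cayley formula for the number of labelled trees, multiplied out. -/
theorem numSpanningTrees_top_mul_sq [Nonempty V] :
    numSpanningTrees (⊤ : SimpleGraph V) * Fintype.card V ^ 2 =
      Fintype.card V ^ Fintype.card V := by
  have h := (isAcyclic_bot (V := V)).numTreesAbove_mul_sq
  have h1 : (⊥ : SimpleGraph V).numTreesAbove = numSpanningTrees (⊤ : SimpleGraph V) := by
    simp [numTreesAbove, numSpanningTrees]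
  have h2 := (isAcyclic_bot (V := V)).card_edgeSet_add_card_connectedComponent
  rw [edgeSet_bot, Set.ncard_empty, zero_add] at h2
  have h3 : (⊥ : SimpleGraph V).compProd = 1 := by
    refine finprod_eq_one_of_forall_eq_one fun c ↦ ?_
    induction c using ConnectedComponent.ind with | _ x
    rw [Set.ncard_eq_one]
    exact ⟨x, by ext; simp⟩
  rwa [h1, h2, h3, mul_one] at h

theorem numSpanningTrees_top [Nonempty V] :
    numSpanningTrees (⊤ : SimpleGraph V) = Fintype.card V ^ (Fintype.card V - 2) := by
  have h := numSpanningTrees_top_mul_sq (V := V)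
  have hpos : 0 < Fintype.card V := Fintype.card_pos
  refine Nat.eq_of_mul_eq_mul_right (pow_pos hpos 2) (h.trans ?_)
  rcases Nat.lt_or_ge (Fintype.card V) 2 with h2 | h2
  · rw [show Fintype.card V = 1 by omega]
    simp
  · rw [← pow_add, Nat.sub_add_cancel h2]

end SimpleGraph

namespace SimpleGraph

section prod

variable {α β : Type*} {G : SimpleGraph (α × β)}

theorem reachable_comap_mk_of_reachable (hG : ∀ x y, G.Adj x y → x.1 = y.1) {x y : α × β}
    (h : G.Reachable x y) : (G.comap (Prod.mk x.1)).Reachable x.2 y.2 := by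
  obtain ⟨p⟩ := h
  induction p with
  | nil => exact .rfl
  | @cons x y z hxy p ih =>
    have h1 := hG _ _ hxy
    rw [← h1] at ih
    refine Reachable.trans (Adj.reachable ?_) ih
    rw [comap_adj]
    convert hxy

/-- Graph on `α × β` which is the disjoint union of graphs on the fibres over `α`. -/
def fiberUnion (T : α → SimpleGraph β) : SimpleGraph (α × β) where
  Adj x y := x.1 = y.1 ∧ (T x.1).Adj x.2 y.2
  symm := ⟨fun _ _ h ↦ ⟨h.1.symm, h.1 ▸ h.2.symm⟩⟩
  loopless := ⟨fun _ h ↦ h.2.ne rfl⟩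

theorem isAcyclic_fiberUnion {T : α → SimpleGraph β} (hT : ∀ a, (T a).IsAcyclic) :
    (fiberUnion T).IsAcyclic := by
  rw [isAcyclic_iff_forall_adj_isBridge]
  rintro ⟨a, x⟩ ⟨_, y⟩ ⟨rfl, hxy⟩ h
  have hle : (fiberUnion T).deleteEdges {s((a, x), (a, y))} ≤ fiberUnion T := deleteEdges_le _
  have h' := reachable_comap_mk_of_reachable (fun _ _ h ↦ (hle h).1) h
  refine isAcyclic_iff_forall_adj_isBridge.1 (hT a) hxy (h'.mono fun u v huv ↦ ?_)
  simp only [comap_adj, deleteEdges_adj, Set.mem_singleton_iff] at huv ⊢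
  refine ⟨huv.1.2, fun he ↦ huv.2 ?_⟩
  simpa using congrArg (Sym2.map (Prod.mk a)) he

theorem reachable_fiberUnion_iff {T : α → SimpleGraph β} (hT : ∀ a, (T a).Connected)
    {x y : α × β} : (fiberUnion T).Reachable x y ↔ x.1 = y.1 := by
  constructor
  · rintro ⟨p⟩
    induction p with
    | nil => rfl
    | cons h _ ih => exact h.1.trans ih
  · obtain ⟨a, x⟩ := x
    obtain ⟨b, y⟩ := y
    rintro rfl
    exact ((hT a).preconnected x y).map (⟨Prod.mk a, fun h ↦ ⟨rfl, h⟩⟩ : T a →g fiberUnion T)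

/-- A forest whose components are the fibres of `Prod.fst` is a family of trees. -/
def forestEquiv (α β : Type*) [Nonempty β] :
    {G : SimpleGraph (α × β) // G.IsAcyclic ∧ ∀ x y, G.Reachable x y ↔ x.1 = y.1} ≃
      (α → {T : SimpleGraph β // T.IsTree}) where
  toFun G a := ⟨G.1.comap (Prod.mk a), ⟨⟨fun x y ↦ reachable_comap_mk_of_reachable
    (fun _ _ h ↦ (G.2.2 _ _).1 h.reachable) ((G.2.2 (a, x) (a, y)).2 rfl)⟩,
    G.2.1.of_comap (Function.Embedding.sectR a β)⟩⟩
  invFun T := ⟨fiberUnion fun a ↦ (T a).1, isAcyclic_fiberUnion fun a ↦ (T a).2.isAcyclic,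
    fun _ _ ↦ reachable_fiberUnion_iff fun a ↦ (T a).2.connected⟩
  left_inv G := by
    ext ⟨a, x⟩ ⟨b, y⟩
    simp only [fiberUnion, comap_adj]
    constructor
    · rintro ⟨rfl, h⟩
      exact h
    · intro h
      obtain rfl := (G.2.2 _ _).1 h.reachable
      exact ⟨rfl, h⟩
  right_inv T := by
    ext a x y
    simp [fiberUnion]

end prod

/-- An identification of `V` with `α × β` carrying the fibres of `f` to those of `Prod.fst`
amounts to a relabelling of the base together with one of each fibre. -/
noncomputable def fiberedEquivEquiv {V C α β : Type*} [Nonempty β] {f : V → C}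
    (hf : Function.Surjective f) :
    {e : V ≃ α × β // ∀ u v, f u = f v ↔ (e u).1 = (e v).1} ≃
      (C ≃ α) × (∀ c, {v // f v = c} ≃ β) where
  toFun e :=
    have hφ : Function.Bijective fun c ↦ (e.1 (Function.surjInv hf c)).1 :=
      ⟨fun c d h ↦ by simpa [Function.surjInv_eq] using (e.2 _ _).2 h,
        fun a ↦ ⟨f (e.1.symm (a, Classical.arbitrary β)), by
          simpa using (e.2 _ _).1 (Function.surjInv_eq hf
            (f (e.1.symm (a, Classical.arbitrary β))))⟩⟩
    ⟨Equiv.ofBijective _ hφ, fun c ↦ Equiv.ofBijective (fun v ↦ (e.1 v).2)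
      ⟨fun u v h ↦ Subtype.ext (e.1.injective (Prod.ext
          ((e.2 _ _).1 (u.2.trans v.2.symm)) h)),
        fun b ↦ ⟨⟨e.1.symm ((e.1 (Function.surjInv hf c)).1, b), by
          conv_rhs => rw [← Function.surjInv_eq hf c]
          rw [e.2]
          simp⟩, by simp⟩⟩⟩
  invFun p := ⟨⟨fun v ↦ (p.1 (f v), p.2 (f v) ⟨v, rfl⟩),
      fun x ↦ ((p.2 (p.1.symm x.1)).symm x.2).1,
      fun v ↦ by
        simp only
        rw [Equiv.symm_apply_apply, Equiv.symm_apply_apply],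
      fun x ↦ by
        have h := ((p.2 (p.1.symm x.1)).symm x.2).2
        refine Prod.ext (by simp [h]) ?_
        have key : ∀ c (v : {v // f v = c}), p.2 (f v) ⟨v, rfl⟩ = p.2 c v := by
          rintro _ ⟨v, rfl⟩
          rfl
        simp [key]⟩,
    fun u v ↦ by simp⟩
  left_inv e := by
    ext v
    · exact (e.2 _ _).1 (Function.surjInv_eq hf (f v))
    · rfl
  right_inv p := by
    refine Prod.ext ?_ ?_
    · ext c
      simp [Function.surjInv_eq]
    · funext c
      ext ⟨v, rfl⟩
      rfl

variable {V : Type*} {H : SimpleGraph V} {k n : ℕ}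

theorem mem_equiForests_of_equiv (e : V ≃ Fin k × Fin n) (hH : H.IsAcyclic)
    (h : ∀ u v, H.Reachable u v ↔ (e u).1 = (e v).1) : H ∈ equiForests V n := by
  refine ⟨hH, fun c ↦ ?_⟩
  induction c using ConnectedComponent.ind with | _ x
  have : (H.connectedComponentMk x).supp = Set.range fun b : Fin n ↦ e.symm ((e x).1, b) := by
    ext y
    simp only [ConnectedComponent.mem_supp_iff, ConnectedComponent.eq, h, Set.mem_range,
      Equiv.symm_apply_eq]
    exact ⟨fun h ↦ ⟨(e y).2, Prod.ext h.symm rfl⟩, fun ⟨b, hb⟩ ↦ by rw [← hb]⟩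
  rw [this, ← Nat.card_coe_set_eq, Nat.card_range_of_injective fun a b hab ↦ by simpa using hab]
  simp

theorem card_forests_of_equiv (hn : 1 ≤ n) (e : V ≃ Fin k × Fin n) :
    Nat.card {H : SimpleGraph V // H.IsAcyclic ∧ ∀ u v, H.Reachable u v ↔ (e u).1 = (e v).1} =
      (n ^ (n - 2)) ^ k := by
  have : Nonempty (Fin n) := ⟨⟨0, hn⟩⟩
  have e' : {H : SimpleGraph V // H.IsAcyclic ∧ ∀ u v, H.Reachable u v ↔ (e u).1 = (e v).1} ≃
      {G : SimpleGraph (Fin k × Fin n) //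
        G.IsAcyclic ∧ ∀ x y, G.Reachable x y ↔ x.1 = y.1} := by
    refine e.simpleGraph.subtypeEquiv fun H ↦ ?_
    let φ : H.comap e.symm ≃g H := Iso.comap e.symm H
    refine and_congr φ.isAcyclic_iff.symm ?_
    rw [e.forall_congr_left]
    refine forall_congr' fun x ↦ ?_
    rw [e.forall_congr_left]
    refine forall_congr' fun y ↦ ?_
    rw [e.apply_symm_apply, e.apply_symm_apply]
    exact iff_congr φ.reachable_iff Iff.rfl
  have hC : Nat.card {T : SimpleGraph (Fin n) // T.IsTree} = n ^ (n - 2) := by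
    have := numSpanningTrees_top (V := Fin n)
    rw [Fintype.card_fin] at this
    rw [← this, numSpanningTrees, ← Nat.card_coe_set_eq]
    simp only [le_top, true_and]
    rfl
  rw [Nat.card_congr (e'.trans (forestEquiv _ _)), Nat.card_pi, Finset.prod_congr rfl fun _ _ ↦ hC]
  simp

variable [Fintype V]

theorem card_fiberedEquiv_of_mem_equiForests (hn : 1 ≤ n) (hV : Fintype.card V = k * n)
    (hH : H ∈ equiForests V n) :
    Nat.card {e : V ≃ Fin k × Fin n // ∀ u v, H.Reachable u v ↔ (e u).1 = (e v).1} =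
      k.factorial * n.factorial ^ k := by
  classical
  have : Nonempty (Fin n) := ⟨⟨0, hn⟩⟩
  have := Fintype.ofFinite H.ConnectedComponent
  have hk := card_connectedComponent_mul hH.2
  rw [hV] at hk
  have hk := Nat.eq_of_mul_eq_mul_right hn hk
  rw [Nat.card_eq_fintype_card] at hk
  have hs : Function.Surjective H.connectedComponentMk := Quot.mk_surjective
  have e := (fiberedEquivEquiv (α := Fin k) (β := Fin n) hs)
  simp only [ConnectedComponent.eq] at e
  have hfib (c : H.ConnectedComponent) :
      Nat.card ({v // H.connectedComponentMk v = c} ≃ Fin n) = n.factorial := by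
    have hc : Fintype.card {v // H.connectedComponentMk v = c} = n :=
      Nat.card_eq_fintype_card.symm.trans (hH.2 c)
    rw [Nat.card_eq_fintype_card, Fintype.card_equiv (Fintype.equivFinOfCardEq hc), hc]
  rw [Nat.card_congr e, Nat.card_prod, Nat.card_pi, Finset.prod_congr rfl fun c _ ↦ hfib c,
    Finset.prod_const, Finset.card_univ, hk, Nat.card_eq_fintype_card,
    Fintype.card_equiv (Fintype.equivFinOfCardEq hk), hk]

theorem ncard_equiForests_mul (hn : 1 ≤ n) (hV : Fintype.card V = k * n) :
    (equiForests V n).ncard * (k.factorial * n.factorial ^ k) =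
      (k * n).factorial * (n ^ (n - 2)) ^ k := by
  classical
  have h := Finset.sum_card_bipartiteAbove_eq_sum_card_bipartiteBelow
    (s := (equiForests V n).toFinset) (t := (Finset.univ : Finset (V ≃ Fin k × Fin n)))
    (fun H e ↦ ∀ u v, H.Reachable u v ↔ (e u).1 = (e v).1)
  have e₀ : V ≃ Fin k × Fin n := Fintype.equivOfCardEq (by simp [hV])
  rw [Finset.sum_congr rfl (g := fun _ ↦ k.factorial * n.factorial ^ k), Finset.sum_const,
    Finset.sum_congr rfl (g := fun _ ↦ (n ^ (n - 2)) ^ k), Finset.sum_const, Finset.card_univ,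
    Fintype.card_equiv e₀, hV, smul_eq_mul, smul_eq_mul, ← Set.ncard_eq_toFinset_card'] at h
  · exact h
  · intro e _
    rw [← card_forests_of_equiv hn e, Finset.bipartiteBelow, Nat.card_eq_fintype_card,
      Fintype.card_subtype]
    congr 1
    ext H
    simp only [Finset.mem_filter, Set.mem_toFinset, Finset.mem_univ, true_and]
    exact ⟨fun h ↦ ⟨h.1.1, h.2⟩, fun h ↦ ⟨mem_equiForests_of_equiv e h.1 h.2, h.2⟩⟩
  · intro H hH
    rw [← card_fiberedEquiv_of_mem_equiForests hn hV (Set.mem_toFinset.1 hH),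
      Finset.bipartiteAbove, Nat.card_eq_fintype_card, Fintype.card_subtype]

end SimpleGraph

/-- The probability that a uniformly random spanning tree of the complete
graph `K_{kn}` is `k`-splittable equals
`((kn)! / ((n!)^k · k!)) · n^((n-2)k) · n^(2(k-1)) · k^(k-2) / (kn)^(kn-2)`. -/
theorem complete_graph_splittable_probability (k n : ℕ) (hk : 1 ≤ k) (hn : 1 ≤ n) :
    (numSplittableSpanningTrees (⊤ : SimpleGraph (Fin (k * n))) k n : ℚ) /
        (numSpanningTrees (⊤ : SimpleGraph (Fin (k * n))) : ℚ) =
      (Nat.factorial (k * n) : ℚ) / ((Nat.factorial n : ℚ) ^ k * Nat.factorial k) *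
        (n : ℚ) ^ ((n - 2) * k) * (n : ℚ) ^ (2 * (k - 1)) * (k : ℚ) ^ (k - 2) /
        ((k * n : ℕ) : ℚ) ^ (k * n - 2) := by
  have : NeZero (k * n) := ⟨(Nat.mul_pos hk hn).ne'⟩
  have hV := Fintype.card_fin (k * n)
  rw [numSpanningTrees_top, hV, Nat.cast_pow]
  congr 1
  have h1 := ncard_equiForests_mul hn hV
  have h2 := numSplittableSpanningTrees_top_mul_sq hn hV
  have h3 : (k * n) ^ k * n ^ k = n ^ (2 * (k - 1)) * k ^ (k - 2) * (k * n) ^ 2 := by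
    obtain rfl | ⟨j, rfl⟩ : k = 1 ∨ ∃ j, k = j + 2 := by
      rcases Nat.lt_or_ge k 2 with h | h
      · exact .inl (by omega)
      · exact .inr ⟨k - 2, by omega⟩
    · simp [sq]
    · rw [show 2 * (j + 2 - 1) = 2 * j + 2 by omega, Nat.add_sub_cancel,
        mul_pow (j + 2) n (j + 2)]
      ring
  rw [h3, ← mul_assoc] at h2
  have h4 := Nat.eq_of_mul_eq_mul_right (pow_pos (Nat.mul_pos hk hn) 2) h2
  have h1' : ((equiForests (Fin (k * n)) n).ncard : ℚ) * (k.factorial * n.factorial ^ k) =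
      (k * n).factorial * (n ^ (n - 2)) ^ k := by exact_mod_cast h1
  have hf : (k.factorial * n.factorial ^ k : ℚ) ≠ 0 := by positivity
  rw [h4]
  push_cast
  rw [eq_div_of_mul_eq hf h1', pow_mul (n : ℚ) (n - 2) k]
  field_simp
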